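/- arXiv:2201.08168 — 5 statements merged into one kernel-verified Lean document; each statement's English description precedes it below -/
import Mathlib

section
/- Let k ≥ 2 and write n = km + j with m ≥ 0 and 0 ≤ j < k. Then mp_C(n,k) = ((j+1)/(km+j+1))·binom((k+1)m + j, km + j). In particular mp_C(km,k) = (1/(km+1))·binom((k+1)m, m), the m-th Fuss–Catalan number. -/
/-- `mp_C(n,k)`: number of words `(f 1, …, f n)` of positive integers with `f 1 = 1`,
`1 ≤ f i ≤ f (i-1) + 1` for `2 ≤ i ≤ n`, and `f i ≡ i (mod k)` for all `i`
(indices written 0-based via `Fin n`). -/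
noncomputable def mpC (k n : ℕ) : ℕ :=
  Nat.card {f : Fin n → ℕ //
    (∀ i : Fin n, (i : ℕ) = 0 → f i = 1) ∧
    (∀ i : Fin n, 1 ≤ f i) ∧
    (∀ i j : Fin n, (j : ℕ) = (i : ℕ) + 1 → f j ≤ f i + 1) ∧
    (∀ i : Fin n, f i % k = ((i : ℕ) + 1) % k)}

/-- Weakly increasing words `g` of length `n`, bounded by `t`, with `k * g i ≤ i`. -/
def ballotWords (k n t : ℕ) : Set (Fin n → ℕ) :=
  {g | Monotone g ∧ (∀ i : Fin n, k * g i ≤ i) ∧ ∀ i, g i ≤ t}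

theorem ballotWords_finite (k n t : ℕ) : (ballotWords k n t).Finite :=
  (Set.Finite.pi' fun _ : Fin n => Set.finite_Iic t).subset fun _ hg => hg.2.2

theorem ncard_ballotWords_zero_right (k n : ℕ) : (ballotWords k n 0).ncard = 1 := by
  rw [Set.ncard_eq_one]
  refine ⟨0, Set.eq_singleton_iff_unique_mem.2 ⟨?_, ?_⟩⟩
  · exact ⟨fun _ _ _ => le_rfl, by simp, by simp⟩
  · rintro g ⟨-, -, hg⟩
    ext i
    simpa using hg i

theorem ballotWords_succ_subset (k n t : ℕ) {g : Fin (n + 1) → ℕ}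
    (hg : g ∈ ballotWords k (n + 1) (t + 1)) (hlast : g (Fin.last n) ≤ t) :
    g ∈ ballotWords k (n + 1) t :=
  ⟨hg.1, hg.2.1, fun i => (hg.1 (Fin.le_last i)).trans hlast⟩

theorem ballotWords_mono (k n t : ℕ) : ballotWords k n t ⊆ ballotWords k n (t + 1) :=
  fun _ hg => ⟨hg.1, hg.2.1, fun i => (hg.2.2 i).trans t.le_succ⟩

theorem ballotWords_succ_of_lt {k n t : ℕ} (h : n < k * (t + 1)) :
    ballotWords k (n + 1) (t + 1) = ballotWords k (n + 1) t := by
  refine Set.Subset.antisymm (fun g hg => ballotWords_succ_subset k n t hg ?_)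
    (ballotWords_mono k (n + 1) t)
  have h₁ : k * g (Fin.last n) ≤ n := by simpa using hg.2.1 (Fin.last n)
  exact Nat.lt_succ_iff.1 (lt_of_mul_lt_mul_left (h₁.trans_lt h) k.zero_le)

theorem ballotWords_succ_of_le {k n t : ℕ} (h : k * (t + 1) ≤ n) :
    ballotWords k (n + 1) (t + 1) = ballotWords k (n + 1) t ∪
      (fun g => (Fin.snoc g (t + 1) : Fin (n + 1) → ℕ)) '' ballotWords k n (t + 1) := by
  refine Set.Subset.antisymm (fun g hg => ?_)
    (Set.union_subset (ballotWords_mono k (n + 1) t) ?_)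
  · by_cases hlast : g (Fin.last n) ≤ t
    · exact Or.inl (ballotWords_succ_subset k n t hg hlast)
    · refine Or.inr ⟨Fin.init g, ⟨fun i j hij => hg.1 (by simpa using hij),
        fun i => by simpa [Fin.init] using hg.2.1 i.castSucc, fun i => hg.2.2 _⟩, ?_⟩
      have h₁ : g (Fin.last n) = t + 1 := le_antisymm (hg.2.2 _) (by omega)
      change Fin.snoc (Fin.init g) (t + 1) = g
      rw [← h₁, Fin.snoc_init_self]
  · rintro _ ⟨g, hg, rfl⟩
    refine ⟨fun i j hij => ?_, fun i => ?_, fun i => ?_⟩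
    · induction j using Fin.lastCases with
      | last =>
        induction i using Fin.lastCases with
        | last => exact le_rfl
        | cast i => simpa using hg.2.2 i
      | cast j =>
        induction i using Fin.lastCases with
        | last => exact absurd hij (not_le.2 (Fin.castSucc_lt_last j))
        | cast i => simpa using hg.1 (by simpa using hij)
    · induction i using Fin.lastCases with
      | last => simpa using h
      | cast i => simpa using hg.2.1 i
    · induction i using Fin.lastCases with
      | last => simp
      | cast i => simpa using hg.2.2 i

theorem ncard_ballotWords_succ_of_le {k n t : ℕ} (h : k * (t + 1) ≤ n) :
    (ballotWords k (n + 1) (t + 1)).ncard =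
      (ballotWords k (n + 1) t).ncard + (ballotWords k n (t + 1)).ncard := by
  rw [ballotWords_succ_of_le h, Set.ncard_union_eq ?_ (ballotWords_finite ..)
    ((ballotWords_finite ..).image _), Set.ncard_image_of_injective]
  · intro g g' hgg'
    simpa using congrArg Fin.init hgg'
  · rw [Set.disjoint_left]
    rintro _ hg ⟨g, -, rfl⟩
    simpa using hg.2.2 (Fin.last n)

theorem ncard_ballotWords (k t n : ℕ) (h : k * t ≤ n) (hk : 0 < k) :
    ((n : ℚ) + 1) * (ballotWords k n t).ncard = (n + 1 - k * t) * (n + t).choose t := by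
  induction t generalizing n with
  | zero => simp [ncard_ballotWords_zero_right]
  | succ t iht =>
    induction n with
    | zero => exact absurd h (not_le.2 (by positivity))
    | succ n ihn =>
      have hW₁ := iht (n + 1) ((Nat.mul_le_mul_left k t.le_succ).trans h)
      have hab : ((n + 1 + t).choose (t + 1) : ℚ) * (t + 1) = (n + 1 + t).choose t * (n + 1) := by
        have := Nat.choose_succ_right_eq (n + 1 + t) t
        rw [Nat.add_sub_cancel] at this
        exact_mod_cast this
      have hpascal : ((n + 1 + (t + 1)).choose (t + 1) : ℚ) =
          (n + 1 + t).choose t + (n + 1 + t).choose (t + 1) := by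
        exact_mod_cast Nat.choose_succ_succ (n + 1 + t) t
      obtain ⟨w, hcard, hw⟩ : ∃ w : ℚ,
          ((ballotWords k (n + 1) (t + 1)).ncard : ℚ) = (ballotWords k (n + 1) t).ncard + w ∧
          (n + 1) * w = (n + 1 - k * (t + 1)) * (n + 1 + t).choose (t + 1) := by
        by_cases hle : k * (t + 1) ≤ n
        · refine ⟨_, by rw [ncard_ballotWords_succ_of_le hle]; push_cast; rfl, ?_⟩
          have := ihn hle
          rw [show n + (t + 1) = n + 1 + t by ring] at this
          exact_mod_cast this
        · refine ⟨0, by rw [ballotWords_succ_of_lt (not_le.1 hle), add_zero], ?_⟩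
          have heq : (k : ℚ) * (t + 1) = n + 1 := by
            exact_mod_cast le_antisymm h (Nat.lt_of_not_le hle)
          rw [heq]
          ring
      have hn : (n : ℚ) + 1 ≠ 0 := by positivity
      apply mul_left_cancel₀ hn
      rw [hpascal, hcard]
      push_cast at hW₁ ⊢
      linear_combination (n + 1 : ℚ) * hW₁ + (n + 2 : ℚ) * hw - (k : ℚ) * hab

theorem Fin.monotone_of_step {n : ℕ} {g : Fin n → ℕ}
    (hg : ∀ i j : Fin n, (j : ℕ) = i + 1 → g i ≤ g j) : Monotone g := by
  cases n with
  | zero => exact fun i => i.elim0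
  | succ n => exact Fin.monotone_iff_le_succ.2 fun i => hg _ _ (by simp)

theorem mpC_eq_ncard_ballotWords {k n t : ℕ} (hk : 0 < k) (hn : n < k * (t + 1)) :
    mpC k n = (ballotWords k n t).ncard := by
  have hinj : Set.InjOn (fun (g : Fin n → ℕ) (i : Fin n) => (i : ℕ) + 1 - k * g i)
      (ballotWords k n t) := by
    intro g hg g' hg' h
    ext i
    have h₁ := congrFun h i
    have h₂ := hg.2.1 i
    have h₃ := hg'.2.1 i
    simp only at h₁
    exact Nat.eq_of_mul_eq_mul_left hk (by omega)
  rw [← hinj.ncard_image, ← Nat.card_coe_set_eq]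
  refine Nat.card_congr (Equiv.setCongr (Set.ext fun f => ⟨?_, ?_⟩))
  · rintro ⟨hfirst, hpos, hstep, hmod⟩
    have hle : ∀ a (ha : a < n), f ⟨a, ha⟩ ≤ a + 1 := by
      intro a
      induction a with
      | zero => intro ha; exact (hfirst _ rfl).le
      | succ a ih =>
        intro ha
        have h₁ := hstep ⟨a, by omega⟩ ⟨a + 1, ha⟩ rfl
        have h₂ := ih (by omega)
        omega
    have hmul : ∀ i : Fin n, k * ((i + 1 - f i) / k) = i + 1 - f i := fun i =>
      Nat.mul_div_cancel' ((Nat.modEq_iff_dvd' (hle i i.2)).1 (hmod i))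
    have hbound : ∀ i : Fin n, k * ((i + 1 - f i) / k) ≤ i := fun i => by
      rw [hmul]
      have := hpos i
      omega
    refine ⟨fun i => (i + 1 - f i) / k, ⟨?_, hbound, fun i => ?_⟩, ?_⟩
    · refine Fin.monotone_of_step fun i j hij => Nat.div_le_div_right ?_
      have := hstep i j hij
      omega
    · have h₁ := hbound i
      exact Nat.lt_succ_iff.1 (lt_of_mul_lt_mul_left ((h₁.trans_lt i.2).trans hn) k.zero_le)
    · ext i
      have h₁ := hmul i
      have h₂ := hle i i.2
      simp only at h₂ ⊢
      change f i ≤ i + 1 at h₂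
      omega
  · rintro ⟨g, hg, rfl⟩
    refine ⟨fun i hi => ?_, fun i => ?_, fun i j hij => ?_, fun i => ?_⟩
    · have := hg.2.1 i
      simp only
      omega
    · have := hg.2.1 i
      simp only
      omega
    · have h₁ := Nat.mul_le_mul_left k (hg.1 (show i ≤ j from Fin.le_def.2 (by omega)))
      simp only
      omega
    · exact Nat.sub_mul_mod ((hg.2.1 i).trans (Nat.le_succ _))

theorem mpC_eq_ballot (k : ℕ) (m j : ℕ) (hj : j < k) :
    (mpC k (k * m + j) : ℚ) =
      (j + 1) / (k * m + j + 1) * ((k + 1) * m + j).choose m := by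
  have hk : 0 < k := j.zero_le.trans_lt hj
  rw [mpC_eq_ncard_ballotWords hk (show k * m + j < k * (m + 1) by rw [mul_add_one]; omega)]
  have h := ncard_ballotWords k m (k * m + j) (Nat.le_add_right _ _) hk
  rw [show k * m + j + m = (k + 1) * m + j by ring] at h
  push_cast at h
  have hne : (k : ℚ) * m + j + 1 ≠ 0 := by positivity
  field_simp
  linear_combination h

theorem mpC_fuss_catalan (k : ℕ) (hk : 2 ≤ k) (m j : ℕ) (hj : j < k) :
    (mpC k (k * m + j) : ℚ) =
      (j + 1) / (k * m + j + 1) * (((k + 1) * m + j).choose (k * m + j)) ∧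
    (∀ m' : ℕ, (mpC k (k * m') : ℚ) = 1 / (k * m' + 1) * (((k + 1) * m').choose m')) := by
  refine ⟨?_, fun m' => by simpa using mpC_eq_ballot k m' 0 (by omega)⟩
  rw [mpC_eq_ballot k m j hj,
    Nat.choose_symm_of_eq_add (show (k + 1) * m + j = m + (k * m + j) by ring)]
end

section
/- For every m ≥ 0, the only parity-alternating permutation of [2m+1] avoiding both 132 and 123 is the decreasing permutation [2m+1, 2m, …, 2, 1], so p_{132,123}(2m+1) = 1. For every m ≥ 1, p_{132,123}(2m) = 2^{m−1}. -/
open Finset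

/-- A permutation `π` of `Fin n` contains the length-3 pattern `σ`
(given as a permutation of `Fin 3`, read as the word `σ 0, σ 1, σ 2`). -/
def Pattern3 {n : ℕ} (σ : Equiv.Perm (Fin 3)) (π : Equiv.Perm (Fin n)) : Prop :=
  ∃ f : Fin 3 → Fin n, StrictMono f ∧ ∀ a b : Fin 3, σ a < σ b ↔ π (f a) < π (f b)

/-- The pattern 123. -/
def pat123 : Equiv.Perm (Fin 3) := 1
/-- The pattern 132. -/
def pat132 : Equiv.Perm (Fin 3) := Equiv.swap 1 2
/-- The pattern 213. -/
def pat213 : Equiv.Perm (Fin 3) := Equiv.swap 0 1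
/-- The pattern 231. -/
def pat231 : Equiv.Perm (Fin 3) := finRotate 3
/-- The pattern 312. -/
def pat312 : Equiv.Perm (Fin 3) := (finRotate 3)⁻¹
/-- The pattern 321. -/
def pat321 : Equiv.Perm (Fin 3) := Equiv.swap 0 2

/-- Mod-k-alternating: `π(i) ≡ i (mod k)` (1-based; equivalently 0-based). -/
def ModKAlt {n : ℕ} (k : ℕ) (π : Equiv.Perm (Fin n)) : Prop :=
  ∀ i : Fin n, (π i : ℕ) % k = (i : ℕ) % k

/-- `π(i) ≡ r + i − 1 (mod k)` for all `i ∈ [n]` (1-based). -/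
def ModKAltR {n : ℕ} (k r : ℕ) (π : Equiv.Perm (Fin n)) : Prop :=
  ∀ i : Fin n, ((π i : ℕ) + 1) % k = (r + (i : ℕ)) % k

/-- `mp_σ(n,k)`: number of mod-k-alternating permutations of `[n]` avoiding `σ`. -/
noncomputable def mpPat (k : ℕ) (σ : Equiv.Perm (Fin 3)) (n : ℕ) : ℕ :=
  Nat.card {π : Equiv.Perm (Fin n) // ModKAlt k π ∧ ¬ Pattern3 σ π}

/-- `mp_σ(n,k,r)`: number of permutations in `MP(n,k,r)` avoiding `σ`. -/
noncomputable def mpPatR (k r : ℕ) (σ : Equiv.Perm (Fin 3)) (n : ℕ) : ℕ :=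
  Nat.card {π : Equiv.Perm (Fin n) // ModKAltR k r π ∧ ¬ Pattern3 σ π}

/-- `mp_{σ,τ}(n,k)`: number of mod-k-alternating permutations of `[n]` avoiding both `σ` and `τ`. -/
noncomputable def mpPat2 (k : ℕ) (σ τ : Equiv.Perm (Fin 3)) (n : ℕ) : ℕ :=
  Nat.card {π : Equiv.Perm (Fin n) // ModKAlt k π ∧ ¬ Pattern3 σ π ∧ ¬ Pattern3 τ π}

/-- The revflip involution: `revflip(π)(i) = n + 1 − π(n + 1 − i)` (1-based). -/
def revflip {n : ℕ} (π : Equiv.Perm (Fin n)) : Equiv.Perm (Fin n) :=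
  (Fin.revPerm.trans π).trans Fin.revPerm

/-- No entry of `τ` is followed by two smaller entries, i.e. `τ` avoids 321 and 312. -/
def AtMostOneSmallerAfter {n : ℕ} (τ : Equiv.Perm (Fin n)) : Prop :=
  ∀ i j k, i < j → j < k → τ j < τ i → τ k < τ i → False

/-- Complementing values turns simultaneous avoidance of 132 and 123 into avoidance of 312 and
321. -/
lemma avoids_132_123_iff {n : ℕ} (π : Equiv.Perm (Fin n)) :
    (¬ Pattern3 pat132 π ∧ ¬ Pattern3 pat123 π) ↔ AtMostOneSmallerAfter (Fin.revPerm * π) := by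
  have mono : ∀ i j k : Fin n, i < j → j < k → StrictMono ![i, j, k] := fun i j k hij hjk =>
    Fin.strictMono_iff_lt_succ.2 fun a => by fin_cases a <;> simpa
  simp only [AtMostOneSmallerAfter, Equiv.Perm.mul_apply, Fin.revPerm_apply, Fin.rev_lt_rev]
  constructor
  · rintro ⟨h132, h123⟩ i j k hij hjk hj hk
    rcases lt_trichotomy (π j) (π k) with h | h | h
    · refine h123 ⟨![i, j, k], mono i j k hij hjk, fun a b => ?_⟩
      fin_cases a <;> fin_cases b <;> simp [pat123, hj, hk, h, h.le, hj.le, hk.le]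
    · exact hjk.ne (π.injective h)
    · have p0 : pat132 0 = 0 := by decide
      have p1 : pat132 1 = 2 := by decide
      have p2 : pat132 2 = 1 := by decide
      refine h132 ⟨![i, j, k], mono i j k hij hjk, fun a b => ?_⟩
      fin_cases a <;> fin_cases b <;> simp [p0, p1, p2, hj, hk, h, h.le, hj.le, hk.le]
  · intro h
    constructor <;> rintro ⟨f, hf, hp⟩ <;>
      exact h (f 0) (f 1) (f 2) (hf (by decide)) (hf (by decide))
        ((hp 0 1).1 (by decide)) ((hp 0 2).1 (by decide))

/-- Every natural number below `n` is a value of a permutation of `Fin n`. -/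
lemma exists_perm_val_eq {n : ℕ} (τ : Equiv.Perm (Fin n)) {a : ℕ} (ha : a < n) :
    ∃ i, (τ i : ℕ) = a :=
  ⟨τ.symm ⟨a, ha⟩, by simp⟩

lemma eq_one_of_parity {n : ℕ} {τ : Equiv.Perm (Fin n)} (h : AtMostOneSmallerAfter τ)
    (hpar : ∀ i, (τ i : ℕ) % 2 = (i : ℕ) % 2) : τ = 1 := by
  have key : ∀ a (ha : a < n), (τ ⟨a, ha⟩ : ℕ) = a := by
    intro a
    induction a using Nat.strong_induction_on with
    | _ a ih =>
      intro ha
      have later : ∀ k, a ≤ (τ k : ℕ) → a ≤ (k : ℕ) := by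
        intro k hk
        by_contra hlt
        have := ih k (by omega) k.2
        simp only [Fin.eta] at this
        omega
      have hge : a ≤ (τ ⟨a, ha⟩ : ℕ) := by
        by_contra hlt
        have hfix := ih (τ ⟨a, ha⟩) (by omega) (τ ⟨a, ha⟩).2
        have := congrArg Fin.val (τ.injective (Fin.ext hfix))
        simp only at this
        omega
      by_contra hne
      have hp := hpar ⟨a, ha⟩
      have hlt := (τ ⟨a, ha⟩).2
      simp only at hp
      obtain ⟨j, hj⟩ := exists_perm_val_eq τ (a := a) ha
      obtain ⟨k, hk⟩ := exists_perm_val_eq τ (a := a + 1) (by omega)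
      have after : ∀ l, a ≤ (τ l : ℕ) → τ l ≠ τ ⟨a, ha⟩ → (⟨a, ha⟩ : Fin n) < l := by
        intro l hl hl'
        refine lt_of_le_of_ne (later l hl) ?_
        rintro rfl
        exact hl' rfl
      have hj' : τ j < τ ⟨a, ha⟩ := Fin.lt_def.2 (by omega)
      have hk' : τ k < τ ⟨a, ha⟩ := Fin.lt_def.2 (by omega)
      have haj := after j (by omega) hj'.ne
      have hak := after k (by omega) hk'.ne
      rcases lt_trichotomy j k with hjk | rfl | hkj
      · exact h _ _ _ haj hjk hj' hk'
      · omega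
      · exact h _ _ _ hak hkj hk' hj'
  ext i
  exact key i i.2

lemma atMostOneSmallerAfter_one {n : ℕ} : AtMostOneSmallerAfter (1 : Equiv.Perm (Fin n)) :=
  fun _ _ _ hij _ hji _ => lt_asymm hij hji

lemma decomposeFin_symm_succ_val {n : ℕ} (p : Fin (n + 1))
    (e : Equiv.Perm (Fin n)) (i : Fin n) :
    (Equiv.Perm.decomposeFin.symm (p, e) i.succ : ℕ) =
      if (e i : ℕ) + 1 = p then 0 else (e i : ℕ) + 1 := by
  rw [Equiv.Perm.decomposeFin_symm_apply_succ, Equiv.swap_apply_def]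
  have h0 : ((e i).succ : Fin (n + 1)) ≠ 0 := Fin.succ_ne_zero _
  simp only [h0, if_false, Fin.ext_iff, Fin.val_succ]
  split_ifs <;> simp

lemma atMostOneSmallerAfter_decomposeFin_symm {n : ℕ} (p : Fin (n + 1))
    (e : Equiv.Perm (Fin n)) :
    AtMostOneSmallerAfter (Equiv.Perm.decomposeFin.symm (p, e)) ↔
      (p : ℕ) ≤ 1 ∧ AtMostOneSmallerAfter e := by
  have lt_iff : (p : ℕ) ≤ 1 → ∀ i j,
      (Equiv.Perm.decomposeFin.symm (p, e) i.succ < Equiv.Perm.decomposeFin.symm (p, e) j.succ ↔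
        e i < e j) := by
    intro hp i j
    rw [Fin.lt_def, Fin.lt_def, decomposeFin_symm_succ_val, decomposeFin_symm_succ_val]
    split_ifs <;> omega
  constructor
  · intro h
    have hp : (p : ℕ) ≤ 1 := by
      by_contra hp
      have h0 : Equiv.Perm.decomposeFin.symm (p, e) 0 = p :=
        Equiv.Perm.decomposeFin_symm_apply_zero p e
      have hpn := p.2
      generalize Equiv.Perm.decomposeFin.symm (p, e) = τ at h h0
      obtain ⟨j, hj⟩ := exists_perm_val_eq τ (a := 0) (by omega)
      obtain ⟨k, hk⟩ := exists_perm_val_eq τ (a := 1) (by omega)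
      have pos : ∀ l, τ l < τ 0 → 0 < l := by
        intro l hl
        refine Fin.pos_iff_ne_zero.2 ?_
        rintro rfl
        exact hl.false
      have hj' : τ j < τ 0 := by rw [h0, Fin.lt_def]; omega
      have hk' : τ k < τ 0 := by rw [h0, Fin.lt_def]; omega
      rcases lt_trichotomy j k with hjk | rfl | hkj
      · exact h _ _ _ (pos j hj') hjk hj' hk'
      · omega
      · exact h _ _ _ (pos k hk') hkj hk' hj'
    refine ⟨hp, fun i j k hij hjk hj hk => h i.succ j.succ k.succ ?_ ?_ ?_ ?_⟩
    · simpa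
    · simpa
    · exact (lt_iff hp _ _).2 hj
    · exact (lt_iff hp _ _).2 hk
  · rintro ⟨hp, h⟩ i j k hij hjk hj hk
    obtain ⟨j, rfl⟩ := Fin.exists_succ_eq.2 (Fin.ne_zero_of_lt hij)
    obtain ⟨k, rfl⟩ := Fin.exists_succ_eq.2 (Fin.ne_zero_of_lt hjk)
    cases i using Fin.cases with
    | zero =>
      rw [Equiv.Perm.decomposeFin_symm_apply_zero, Fin.lt_def,
        decomposeFin_symm_succ_val] at hj hk
      have hne : (e j : ℕ) ≠ e k := fun hjk' =>
        hjk.ne (congrArg Fin.succ (e.injective (Fin.ext hjk')))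
      split_ifs at hj hk <;> omega
    | succ i =>
      exact h i j k (by simpa using hij) (by simpa using hjk) ((lt_iff hp _ _).1 hj)
        ((lt_iff hp _ _).1 hk)

/-- Avoiders of 321 and 312 all of whose entries differ in parity from their position. -/
def OppositeParityAvoider {n : ℕ} (τ : Equiv.Perm (Fin n)) : Prop :=
  AtMostOneSmallerAfter τ ∧ ∀ i, (τ i : ℕ) % 2 ≠ (i : ℕ) % 2

/-- Avoiders of 321 and 312 whose nonzero entries differ in parity from their position, while the
entry `0` is at an even position. -/
def OppositeParityAvoiderExceptZero {n : ℕ} (τ : Equiv.Perm (Fin n)) : Prop :=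
  AtMostOneSmallerAfter τ ∧
    ∀ i, if (τ i : ℕ) = 0 then (i : ℕ) % 2 = 0 else (τ i : ℕ) % 2 ≠ (i : ℕ) % 2

lemma oppositeParityAvoider_decomposeFin_symm {n : ℕ} (p : Fin (n + 1))
    (e : Equiv.Perm (Fin n)) :
    OppositeParityAvoider (Equiv.Perm.decomposeFin.symm (p, e)) ↔
      (p : ℕ) = 1 ∧ OppositeParityAvoiderExceptZero e := by
  unfold OppositeParityAvoider OppositeParityAvoiderExceptZero
  rw [atMostOneSmallerAfter_decomposeFin_symm, Fin.forall_fin_succ,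
    Equiv.Perm.decomposeFin_symm_apply_zero]
  by_cases hp : (p : ℕ) ≤ 1
  · have hpar : (p : ℕ) % 2 ≠ ((0 : Fin (n + 1)) : ℕ) % 2 ↔ (p : ℕ) = 1 := by
      simp only [Fin.val_zero]
      omega
    simp only [decomposeFin_symm_succ_val, Fin.val_succ, hpar, hp, true_and]
    rw [and_left_comm]
    refine and_congr_right fun hp1 => and_congr_right fun _ => forall_congr' fun i => ?_
    rw [hp1]
    split_ifs <;> omega
  · have : (p : ℕ) ≠ 1 := by omega
    simp [hp, this]

lemma oppositeParityAvoiderExceptZero_decomposeFin_symm {n : ℕ} (p : Fin (n + 1))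
    (e : Equiv.Perm (Fin n)) :
    OppositeParityAvoiderExceptZero (Equiv.Perm.decomposeFin.symm (p, e)) ↔
      (p : ℕ) ≤ 1 ∧ OppositeParityAvoider e := by
  unfold OppositeParityAvoider OppositeParityAvoiderExceptZero
  rw [atMostOneSmallerAfter_decomposeFin_symm, Fin.forall_fin_succ,
    Equiv.Perm.decomposeFin_symm_apply_zero, and_assoc]
  refine and_congr_right fun hp => and_congr_right fun _ => ?_
  have hzero : if (p : ℕ) = 0 then ((0 : Fin (n + 1)) : ℕ) % 2 = 0
      else (p : ℕ) % 2 ≠ ((0 : Fin (n + 1)) : ℕ) % 2 := by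
    simp only [Fin.val_zero]
    split_ifs
    omega
  simp only [hzero, true_and, decomposeFin_symm_succ_val, Fin.val_succ]
  refine forall_congr' fun i => ?_
  by_cases hi : (e i : ℕ) + 1 = p
  · simp only [hi, if_true]
    omega
  · simp only [hi, if_false, Nat.succ_ne_zero]
    omega

lemma card_perm_succ_eq_mul {n : ℕ} {P : Equiv.Perm (Fin (n + 1)) → Prop} {Q : Fin (n + 1) → Prop}
    {R : Equiv.Perm (Fin n) → Prop}
    (h : ∀ p e, P (Equiv.Perm.decomposeFin.symm (p, e)) ↔ Q p ∧ R e) :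
    Nat.card {τ // P τ} = Nat.card {p // Q p} * Nat.card {e // R e} := by
  rw [← Nat.card_prod]
  refine Nat.card_congr (Equiv.trans ?_ (Equiv.subtypeProdEquivProd (p := Q) (q := R)))
  exact (Equiv.subtypeEquiv Equiv.Perm.decomposeFin.symm fun pe => (h pe.1 pe.2).symm).symm

lemma card_fin_val_eq_one (n : ℕ) : Nat.card {p : Fin (n + 2) // (p : ℕ) = 1} = 1 :=
  Nat.card_eq_one_iff_exists.2 ⟨⟨1, rfl⟩, fun q => Subtype.ext (Fin.ext q.2)⟩

lemma card_fin_val_le_one (n : ℕ) : Nat.card {p : Fin (n + 2) // (p : ℕ) ≤ 1} = 2 := by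
  refine (Nat.card_congr (β := Fin 2) ?_).trans (Nat.card_fin 2)
  exact
    { toFun := fun p => ⟨p.1, Nat.lt_succ_of_le p.2⟩
      invFun := fun q => ⟨⟨q, by omega⟩, Nat.le_of_lt_succ q.2⟩
      left_inv := fun _ => rfl
      right_inv := fun _ => rfl }

lemma card_oppositeParityAvoider_zero :
    Nat.card {τ : Equiv.Perm (Fin 0) // OppositeParityAvoider τ} = 1 :=
  Nat.card_eq_one_iff_exists.2
    ⟨⟨1, atMostOneSmallerAfter_one, fun i => i.elim0⟩, fun _ => Subsingleton.elim _ _⟩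

lemma card_oppositeParityAvoider (m : ℕ) :
    Nat.card {τ : Equiv.Perm (Fin (2 * m + 2)) // OppositeParityAvoider τ} = 2 ^ m := by
  induction m with
  | zero =>
    have hle : Nat.card {p : Fin 1 // (p : ℕ) ≤ 1} = 1 :=
      Nat.card_eq_one_iff_exists.2 ⟨⟨0, by simp⟩, fun _ => Subsingleton.elim _ _⟩
    rw [card_perm_succ_eq_mul oppositeParityAvoider_decomposeFin_symm, card_fin_val_eq_one,
      card_perm_succ_eq_mul oppositeParityAvoiderExceptZero_decomposeFin_symm, hle,
      card_oppositeParityAvoider_zero]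
    rfl
  | succ m ih =>
    rw [card_perm_succ_eq_mul oppositeParityAvoider_decomposeFin_symm, card_fin_val_eq_one,
      card_perm_succ_eq_mul oppositeParityAvoiderExceptZero_decomposeFin_symm]
    rw [show 2 * (m + 1) = 2 * m + 2 from rfl, card_fin_val_le_one, ih, pow_succ]
    ring

lemma revPerm_mul_self {n : ℕ} : (Fin.revPerm : Equiv.Perm (Fin n)) * Fin.revPerm = 1 := by
  ext i
  simp

lemma avoider_odd_iff (m : ℕ) (π : Equiv.Perm (Fin (2 * m + 1))) :
    (ModKAlt 2 π ∧ ¬ Pattern3 pat132 π ∧ ¬ Pattern3 pat123 π) ↔ π = Fin.revPerm := by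
  rw [avoids_132_123_iff]
  constructor
  · rintro ⟨hpar, h⟩
    have hone := eq_one_of_parity h fun i => by
      have := hpar i
      simp only [Equiv.Perm.mul_apply, Fin.revPerm_apply, Fin.val_rev]
      omega
    rw [← one_mul π, ← revPerm_mul_self, mul_assoc, hone, mul_one]
  · rintro rfl
    rw [revPerm_mul_self]
    refine ⟨fun i => ?_, atMostOneSmallerAfter_one⟩
    simp only [Fin.revPerm_apply, Fin.val_rev]
    omega

lemma modKAlt_two_and_avoids_iff (m : ℕ) (π : Equiv.Perm (Fin (2 * m))) :
    (ModKAlt 2 π ∧ ¬ Pattern3 pat132 π ∧ ¬ Pattern3 pat123 π) ↔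
      OppositeParityAvoider (Fin.revPerm * π) := by
  rw [avoids_132_123_iff, and_comm]
  refine and_congr_right fun _ => forall_congr' fun i => ?_
  simp only [Equiv.Perm.mul_apply, Fin.revPerm_apply, Fin.val_rev]
  omega

theorem pap_132_123_count :
    (∀ m : ℕ, mpPat2 2 pat132 pat123 (2 * m + 1) = 1 ∧
      ∀ π : Equiv.Perm (Fin (2 * m + 1)),
        (ModKAlt 2 π ∧ ¬ Pattern3 pat132 π ∧ ¬ Pattern3 pat123 π) ↔ π = Fin.revPerm) ∧
    (∀ m : ℕ, 1 ≤ m → mpPat2 2 pat132 pat123 (2 * m) = 2 ^ (m - 1)) := by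
  refine ⟨fun m => ⟨?_, avoider_odd_iff m⟩, fun m hm => ?_⟩
  · unfold mpPat2
    simp only [avoider_odd_iff]
    exact Nat.card_unique
  · obtain ⟨m, rfl⟩ := Nat.exists_eq_add_of_le' hm
    rw [Nat.add_sub_cancel, ← card_oppositeParityAvoider]
    exact Nat.card_congr
      (Equiv.subtypeEquiv (Equiv.mulLeft Fin.revPerm) (modKAlt_two_and_avoids_iff (m + 1)))
end

section
/- Let k ≥ 3 and n ≥ 3, and write n = km + l with 0 ≤ l < k. Then the number mp_{132,123}(n,k) of mod-k-alternating permutations of [n] avoiding both 132 and 123 equals 1 if (k,l) ∈ {(3,1), (3,2), (4,2)}, and equals 0 otherwise. -/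
open Finset

/-- `p` restricts to a mod-`k`-alternating permutation of `{0, …, n - 1}` in which every entry has at
most one larger entry to its right. -/
structure IsModAltWord (n k : ℕ) (p : ℕ → ℕ) : Prop where
  lt : ∀ i < n, p i < n
  inj : ∀ i < n, ∀ j < n, p i = p j → i = j
  mod : ∀ i < n, p i % k = i % k
  avoid : ∀ a b c, a < b → b < c → c < n → p a < p b → p a < p c → False

namespace IsModAltWord

variable {n k : ℕ} {p : ℕ → ℕ}

theorem surj (h : IsModAltWord n k p) (v : ℕ) (hv : v < n) : ∃ i < n, p i = v := by
  have := Finset.surj_on_of_inj_on_of_card_le (s := Finset.range n) (t := Finset.range n) (fun i _ => p i)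
    (fun i hi => by simpa using h.lt i (by simpa using hi))
    (fun i j hi hj e => h.inj i (by simpa using hi) j (by simpa using hj) e) le_rfl v (by simpa)
  obtain ⟨i, hi, e⟩ := this
  exact ⟨i, by simpa using hi, e.symm⟩

theorem avoid_of_ne (h : IsModAltWord n k p) {a b c : ℕ} (hab : a < b) (hac : a < c) (hbc : b ≠ c)
    (hb : b < n) (hc : c < n) (h1 : p a < p b) (h2 : p a < p c) : False := by
  rcases lt_or_gt_of_ne hbc with hlt | hlt
  · exact h.avoid a b c hab hlt hc h1 h2
  · exact h.avoid a c b hac hlt hb h2 h1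

/-- The first `i` positions carry exactly the `i` largest values. -/
def TopPrefix (n : ℕ) (p : ℕ → ℕ) (i : ℕ) : Prop := ∀ j < n, j < i ↔ n ≤ p j + i

theorem topPrefix_zero (h : IsModAltWord n k p) : TopPrefix n p 0 := fun j hj => by
  have := h.lt j hj
  omega

/-- After a prefix carrying the largest values, the next largest value comes either at once or
immediately after its predecessor. -/
theorem step (hk : 3 ≤ k) (h : IsModAltWord n k p) {i : ℕ} (hi : i < n) (hP : TopPrefix n p i) :
    (p i + i + 1 = n ∧ TopPrefix n p (i + 1)) ∨
    (i + 1 < n ∧ p i + i + 2 = n ∧ p (i + 1) + i + 1 = n ∧ TopPrefix n p (i + 2)) := by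
  have hPi := hP i hi
  obtain ⟨x, hx, hpx⟩ := h.surj (n - 1 - i) (by omega)
  have hxi := hP x hx
  by_cases hxe : x = i
  · subst hxe
    refine Or.inl ⟨by omega, fun j hj => ?_⟩
    have := hP j hj
    have := h.inj j hj x hx
    grind
  right
  have hin : i + 1 < n := by omega
  obtain ⟨y, hy, hpy⟩ := h.surj (n - 2 - i) (by omega)
  have hyi := hP y hy
  have hxy : x ≠ y := by rintro rfl; omega
  have hyi : y = i := by
    by_contra hne
    refine h.avoid_of_ne (a := i) (b := x) (c := y) (by omega) (by omega) hxy hx hy ?_ ?_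
    · have : p i ≠ p x := fun e => hxe (h.inj i hi x hx e).symm
      omega
    · have : p i ≠ p y := fun e => hne (h.inj i hi y hy e).symm
      have : p i ≠ p x := fun e => hxe (h.inj i hi x hx e).symm
      omega
  subst hyi
  have hxs : x = y + 1 := by
    by_contra hne
    have n1 : p (y + 1) ≠ p x := fun e => hne (h.inj _ hin x hx e).symm
    have n2 : p (y + 1) ≠ p y := fun e => by have := h.inj _ hin y hy e; omega
    have := hP (y + 1) hin
    have hn : y + 3 ≤ n := by omega
    obtain ⟨z, hz, hpz⟩ := h.surj (n - 3 - y) (by omega)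
    have hzP := hP z hz
    have hzx : z ≠ x := by rintro rfl; omega
    have hzy : z ≠ y := by rintro rfl; omega
    by_cases hzs : z = y + 1
    · subst hzs
      have m1 := (Nat.modEq_iff_dvd.1 (h.mod y hy))
      have m2 := (Nat.modEq_iff_dvd.1 (h.mod (y + 1) hin))
      have e1 : (p y : ℤ) = n - 2 - y := by omega
      have e2 : (p (y + 1) : ℤ) = n - 3 - y := by omega
      have hdvd : (k : ℤ) ∣ 2 := (dvd_sub m2 m1).trans (dvd_of_eq (by push_cast; omega))
      have := Int.le_of_dvd (by norm_num) hdvd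
      omega
    · have n3 : p (y + 1) ≠ p z := fun e => hzs (h.inj _ hin z hz e).symm
      exact h.avoid_of_ne (a := y + 1) (b := x) (c := z) (by omega) (by omega) (Ne.symm hzx) hx hz
        (by omega) (by omega)
  subst hxs
  refine ⟨hin, by omega, by omega, fun j hj => ?_⟩
  have := hP j hj
  have := h.inj j hj y hy
  have := h.inj j hj (y + 1) hin
  grind

theorem classify (hk : 3 ≤ k) {m l : ℕ} (hn : 3 ≤ n) (hnm : n = k * m + l) (hl : l < k)
    (h : IsModAltWord n k p) : (k = 3 ∧ l = 1) ∨ (k = 3 ∧ l = 2) ∨ (k = 4 ∧ l = 2) := by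
  have dv : ∀ i < n, (k : ℤ) ∣ i - p i := fun i hi => Nat.modEq_iff_dvd.1 (h.mod i hi)
  have hN : (k : ℤ) ∣ n - l := ⟨m, by rw [hnm]; push_cast; ring⟩
  have bound : ∀ d : ℕ, 0 < d → (k : ℤ) ∣ d → k ≤ d := fun d hd hdv =>
    Nat.le_of_dvd hd (by exact_mod_cast hdv)
  have small : ∀ c : ℕ, c < 3 → (k : ℤ) ∣ n - c → l = c := fun c hc hdv => by
    have h1 : (k : ℤ) ∣ l - c := by simpa using dvd_sub hdv hN
    have h2 := Int.eq_zero_of_abs_lt_dvd h1 (by rw [abs_lt]; omega)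
    omega
  rcases h.step hk (by omega) h.topPrefix_zero with ⟨e0, P1⟩ | ⟨-, e0, -, P2⟩
  · have d0 := dv 0 (by omega)
    have l1 : l = 1 := small 1 (by norm_num)
      ((dvd_neg.2 d0).trans (dvd_of_eq (by push_cast; omega)))
    have d1 := dv 1 (by omega)
    rw [zero_add] at P1
    rcases h.step hk (by omega) P1 with ⟨e1, -⟩ | ⟨-, e1, -, -⟩
    · have := bound 2 (by norm_num) ((dvd_sub d1 d0).trans (dvd_of_eq (by push_cast; omega)))
      omega
    · have := bound 3 (by norm_num) ((dvd_sub d1 d0).trans (dvd_of_eq (by push_cast; omega)))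
      omega
  · have d0 := dv 0 (by omega)
    have l2 : l = 2 := small 2 (by norm_num)
      ((dvd_neg.2 d0).trans (dvd_of_eq (by push_cast; omega)))
    have d2 := dv 2 (by omega)
    rw [zero_add] at P2
    rcases h.step hk (by omega) P2 with ⟨e2, -⟩ | ⟨-, e2, -, -⟩
    · have := bound 3 (by norm_num) ((dvd_sub d2 d0).trans (dvd_of_eq (by push_cast; omega)))
      omega
    · have := bound 4 (by norm_num) ((dvd_sub d2 d0).trans (dvd_of_eq (by push_cast; omega)))
      omega

end IsModAltWord

/-- A permutation of `Fin n` as a function on `ℕ`. -/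
def permWord {n : ℕ} (π : Equiv.Perm (Fin n)) (i : ℕ) : ℕ := if h : i < n then π ⟨i, h⟩ else i

theorem permWord_val {n : ℕ} (π : Equiv.Perm (Fin n)) (i : Fin n) : permWord π i = π i := by
  simp [permWord]

theorem pattern3_iff {n : ℕ} (σ : Equiv.Perm (Fin 3)) (π : Equiv.Perm (Fin n)) :
    Pattern3 σ π ↔ ∃ a b c : Fin n, a < b ∧ b < c ∧
      (σ 0 < σ 1 ↔ π a < π b) ∧ (σ 0 < σ 2 ↔ π a < π c) ∧ (σ 1 < σ 2 ↔ π b < π c) := by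
  constructor
  · rintro ⟨f, hf, h⟩
    exact ⟨f 0, f 1, f 2, hf (by decide), hf (by decide), h _ _, h _ _, h _ _⟩
  · rintro ⟨a, b, c, hab, hbc, h1, h2, h3⟩
    have n1 : π a ≠ π b := fun e => hab.ne (π.injective e)
    have n2 : π a ≠ π c := fun e => (hab.trans hbc).ne (π.injective e)
    have n3 : π b ≠ π c := fun e => hbc.ne (π.injective e)
    have s1 : σ 0 ≠ σ 1 := fun e => absurd (σ.injective e) (by decide)
    have s2 : σ 0 ≠ σ 2 := fun e => absurd (σ.injective e) (by decide)
    have s3 : σ 1 ≠ σ 2 := fun e => absurd (σ.injective e) (by decide)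
    refine ⟨![a, b, c], ?_, ?_⟩
    · intro i j hij
      fin_cases i <;> fin_cases j <;> simp_all [hab.trans hbc]
    · intro i j
      fin_cases i <;> fin_cases j <;> simp <;> omega

theorem isModAltWord_permWord_iff {n k : ℕ} (π : Equiv.Perm (Fin n)) :
    IsModAltWord n k (permWord π) ↔
      ModKAlt k π ∧ ¬ Pattern3 pat132 π ∧ ¬ Pattern3 pat123 π := by
  have s132 : pat132 0 = 0 ∧ pat132 1 = 2 ∧ pat132 2 = 1 := by decide
  have s123 : pat123 0 = 0 ∧ pat123 1 = 1 ∧ pat123 2 = 2 := by decide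
  obtain ⟨s1, s2, s3⟩ := s132
  obtain ⟨t1, t2, t3⟩ := s123
  simp only [pattern3_iff, s1, s2, s3, t1, t2, t3]
  constructor
  · intro h
    have av : ∀ a b c : Fin n, a < b → b < c → π a < π b → π a < π c → False := by
      intro a b c hab hbc h1 h2
      refine h.avoid a b c hab hbc c.2 ?_ ?_ <;> simpa only [permWord_val]
    refine ⟨fun i => ?_, ?_, ?_⟩
    · simpa [permWord_val] using h.mod i i.2
    · rintro ⟨a, b, c, hab, hbc, h1, h2, -⟩
      exact av a b c hab hbc (h1.1 (by decide)) (h2.1 (by decide))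
    · rintro ⟨a, b, c, hab, hbc, h1, h2, -⟩
      exact av a b c hab hbc (h1.1 (by decide)) (h2.1 (by decide))
  · rintro ⟨hm, h132, h123⟩
    refine ⟨fun i hi => ?_, fun i hi j hj e => ?_, fun i hi => ?_, ?_⟩
    · simp [permWord, hi]
    · simpa [permWord, hi, hj, Fin.val_inj] using e
    · simpa [permWord, hi] using hm ⟨i, hi⟩
    · intro a b c hab hbc hc h1 h2
      have hb := hbc.trans hc
      have ha := hab.trans hb
      simp only [permWord, ha, hb, hc, dif_pos, Fin.val_fin_lt] at h1 h2
      have hne : π ⟨b, hb⟩ ≠ π ⟨c, hc⟩ := fun e => by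
        have := π.injective e
        simp at this
        omega
      rcases lt_or_gt_of_ne hne with hlt | hlt
      · exact h123 ⟨⟨a, ha⟩, ⟨b, hb⟩, ⟨c, hc⟩, hab, hbc, by simp [h1], by simp [h2],
          by simp [hlt]⟩
      · exact h132 ⟨⟨a, ha⟩, ⟨b, hb⟩, ⟨c, hc⟩, hab, hbc, by simp [h1], by simp [h2],
          by simp [hlt.le]⟩

theorem mpPat2_eq_one {n k : ℕ} {e : ℕ → ℕ} (he : IsModAltWord n k e)
    (huniq : ∀ p, IsModAltWord n k p → ∀ i < n, p i = e i) : mpPat2 k pat132 pat123 n = 1 := by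
  have hinj : Function.Injective (fun i : Fin n => (⟨e i, he.lt i i.2⟩ : Fin n)) := fun i j h =>
    Fin.ext (he.inj i i.2 j j.2 (by simpa using h))
  let π := Equiv.ofBijective _ (Finite.injective_iff_bijective.1 hinj)
  have hπ : ∀ i < n, permWord π i = e i := fun i hi => by simp [permWord, hi, π]
  have hword : IsModAltWord n k (permWord π) := by
    refine ⟨fun i hi => ?_, fun i hi j hj h => ?_, fun i hi => ?_, fun a b c hab hbc hc h1 h2 => ?_⟩
    · exact hπ i hi ▸ he.lt i hi
    · exact he.inj i hi j hj (by rwa [hπ i hi, hπ j hj] at h)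
    · exact hπ i hi ▸ he.mod i hi
    · rw [hπ a (by omega), hπ b (by omega)] at h1
      rw [hπ a (by omega), hπ c hc] at h2
      exact he.avoid a b c hab hbc hc h1 h2
  rw [mpPat2, Nat.card_eq_one_iff_exists]
  refine ⟨⟨π, (isModAltWord_permWord_iff π).1 hword⟩, ?_⟩
  rintro ⟨ρ, hρ⟩
  refine Subtype.ext (Equiv.ext fun i => Fin.ext ?_)
  have h1 := huniq _ ((isModAltWord_permWord_iff ρ).2 hρ) i i.2
  rw [← hπ i i.2, permWord_val, permWord_val] at h1
  exact h1

theorem mpPat2_three_of_mod_one {n : ℕ} (hn : n % 3 = 1) : mpPat2 3 pat132 pat123 n = 1 := by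
  refine mpPat2_eq_one (e := fun i => if i % 3 = 0 then n - 1 - i else
    if i % 3 = 1 then n - 2 - i else n - i) ⟨?_, ?_, ?_, ?_⟩ fun p h => ?_
  · grind
  · grind
  · grind
  · grind
  · have key : ∀ t, 3 * t < n → IsModAltWord.TopPrefix n p (3 * t) := by
      intro t
      induction t with
      | zero => exact fun _ => h.topPrefix_zero
      | succ t ih =>
        intro ht
        have m0 := h.mod (3 * t) (by omega)
        have m1 := h.mod (3 * t + 1) (by omega)
        rcases h.step le_rfl (by omega) (ih (by omega)) with ⟨e, P⟩ | ⟨_, e, e', P⟩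
        · rcases h.step le_rfl (by omega) P with ⟨e1, P1⟩ | ⟨_, e1, e1', P1⟩
          · omega
          · exact P1
        · omega
    intro i hi
    have m0 := h.mod (3 * (i / 3)) (by omega)
    rcases h.step le_rfl (by omega) (key (i / 3) (by omega)) with ⟨e, P⟩ | ⟨_, e, e', P⟩
    · by_cases hi0 : i % 3 = 0
      · have : 3 * (i / 3) = i := by omega
        grind
      · have m1 := h.mod (3 * (i / 3) + 1) (by omega)
        rcases h.step le_rfl (by omega) P with ⟨e1, P1⟩ | ⟨_, e1, e1', P1⟩
        · omega
        · have : i = 3 * (i / 3) + 1 ∨ i = 3 * (i / 3) + 1 + 1 := by omega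
          grind
    · omega

theorem mpPat2_three_of_mod_two {n : ℕ} (hn : n % 3 = 2) : mpPat2 3 pat132 pat123 n = 1 := by
  refine mpPat2_eq_one (e := fun i => if i % 3 = 0 then n - 2 - i else
    if i % 3 = 1 then n - i else n - 1 - i) ⟨?_, ?_, ?_, ?_⟩ fun p h => ?_
  · grind
  · grind
  · grind
  · grind
  · have key : ∀ t, 3 * t < n → IsModAltWord.TopPrefix n p (3 * t) := by
      intro t
      induction t with
      | zero => exact fun _ => h.topPrefix_zero
      | succ t ih =>
        intro ht
        have m0 := h.mod (3 * t) (by omega)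
        have m2 := h.mod (3 * t + 2) (by omega)
        rcases h.step le_rfl (by omega) (ih (by omega)) with ⟨e, P⟩ | ⟨_, e, e', P⟩
        · omega
        · rcases h.step le_rfl (by omega) P with ⟨e1, P1⟩ | ⟨_, e1, e1', P1⟩
          · exact P1
          · omega
    intro i hi
    have m0 := h.mod (3 * (i / 3)) (by omega)
    rcases h.step le_rfl (by omega) (key (i / 3) (by omega)) with ⟨e, P⟩ | ⟨_, e, e', P⟩
    · omega
    · by_cases hi2 : i % 3 = 2
      · have m2 := h.mod (3 * (i / 3) + 2) (by omega)
        rcases h.step le_rfl (by omega) P with ⟨e1, P1⟩ | ⟨_, e1, e1', P1⟩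
        · have : i = 3 * (i / 3) + 2 := by omega
          grind
        · omega
      · have : i = 3 * (i / 3) ∨ i = 3 * (i / 3) + 1 := by omega
        grind

theorem mpPat2_four_of_mod_two {n : ℕ} (hn : n % 4 = 2) : mpPat2 4 pat132 pat123 n = 1 := by
  refine mpPat2_eq_one (e := fun i => if i % 2 = 0 then n - 2 - i else n - i)
    ⟨?_, ?_, ?_, ?_⟩ fun p h => ?_
  · grind
  · grind
  · grind
  · grind
  · have key : ∀ t, 2 * t < n → IsModAltWord.TopPrefix n p (2 * t) := by
      intro t
      induction t with
      | zero => exact fun _ => h.topPrefix_zero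
      | succ t ih =>
        intro ht
        have m0 := h.mod (2 * t) (by omega)
        rcases h.step (by norm_num) (by omega) (ih (by omega)) with ⟨e, P⟩ | ⟨_, e, e', P⟩
        · omega
        · exact P
    intro i hi
    have m0 := h.mod (2 * (i / 2)) (by omega)
    rcases h.step (by norm_num) (by omega) (key (i / 2) (by omega)) with ⟨e, P⟩ | ⟨_, e, e', P⟩
    · omega
    · have : i = 2 * (i / 2) ∨ i = 2 * (i / 2) + 1 := by omega
      grind

theorem mp_132_123_count (k n m l : ℕ) (hk : 3 ≤ k) (hn : 3 ≤ n)
    (hnm : n = k * m + l) (hl : l < k) :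
    mpPat2 k pat132 pat123 n =
      if (k = 3 ∧ l = 1) ∨ (k = 3 ∧ l = 2) ∨ (k = 4 ∧ l = 2) then 1 else 0 := by
  split_ifs with hc
  · rcases hc with ⟨rfl, rfl⟩ | ⟨rfl, rfl⟩ | ⟨rfl, rfl⟩
    · exact mpPat2_three_of_mod_one (by omega)
    · exact mpPat2_three_of_mod_two (by omega)
    · exact mpPat2_four_of_mod_two (by omega)
  · have : IsEmpty {π : Equiv.Perm (Fin n) //
        ModKAlt k π ∧ ¬ Pattern3 pat132 π ∧ ¬ Pattern3 pat123 π} :=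
      ⟨fun π => hc (((isModAltWord_permWord_iff π.1).2 π.2).classify hk hn hnm hl)⟩
    exact Nat.card_of_isEmpty
end

section
/- For every m ≥ 1, p_{231,123}(2m) = m; moreover every parity-alternating permutation of [2m] avoiding both 231 and 123 has the form [j, j−1, …, 2, 1, 2m, 2m−1, …, j+1] for some odd j ∈ [2m]. -/
open Finset

theorem pattern3_pat231_iff {n : ℕ} (π : Equiv.Perm (Fin n)) :
    Pattern3 pat231 π ↔ ∃ a b c : Fin n, a < b ∧ b < c ∧ π c < π a ∧ π a < π b := by
  constructor
  · rintro ⟨f, hf, h⟩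
    exact ⟨f 0, f 1, f 2, hf (by decide), hf (by decide),
      (h 2 0).1 (by decide), (h 0 1).1 (by decide)⟩
  · rintro ⟨a, b, c, hab, hbc, hca, hab'⟩
    refine ⟨![a, b, c], ?_, ?_⟩
    · intro x y hxy
      fin_cases x <;> fin_cases y <;> simp_all
      exact hab.trans hbc
    · intro x y
      fin_cases x <;> fin_cases y <;> simp [pat231] <;> omega

theorem pattern3_pat123_iff {n : ℕ} (π : Equiv.Perm (Fin n)) :
    Pattern3 pat123 π ↔ ∃ a b c : Fin n, a < b ∧ b < c ∧ π a < π b ∧ π b < π c := by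
  constructor
  · rintro ⟨f, hf, h⟩
    exact ⟨f 0, f 1, f 2, hf (by decide), hf (by decide),
      (h 0 1).1 (by decide), (h 1 2).1 (by decide)⟩
  · rintro ⟨a, b, c, hab, hbc, hab', hbc'⟩
    refine ⟨![a, b, c], ?_, ?_⟩
    · intro x y hxy
      fin_cases x <;> fin_cases y <;> simp_all
      exact hab.trans hbc
    · intro x y
      fin_cases x <;> fin_cases y <;> simp [pat123] <;> omega

/-- The value of a permutation at `i` counts the positions holding smaller values. -/
theorem perm_val_eq_card {n : ℕ} (π : Equiv.Perm (Fin n)) (i : Fin n) :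
    (π i : ℕ) = #{k : Fin n | π k < π i} := by
  rw [← Fin.card_Iio (π i), ← Finset.card_map π.symm.toEmbedding]
  congr 1
  ext v
  simp only [mem_map_equiv, mem_filter, mem_univ, true_and, mem_Iio, Equiv.symm_symm]

/-- In 0-based notation, the word `p, p - 1, …, 0, n - 1, n - 2, …, p + 1`. -/
def twoBlockFun (n : ℕ) (p i : Fin n) : Fin n :=
  ⟨if (i : ℕ) ≤ p then p - i else n + p - i, by split_ifs <;> omega⟩

theorem twoBlockFun_involutive (n : ℕ) (p : Fin n) :
    Function.Involutive (twoBlockFun n p) := by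
  intro i
  ext
  simp only [twoBlockFun]
  split_ifs <;> omega

/-- The permutation with word `twoBlockFun n p`. -/
def twoBlockPerm (n : ℕ) (p : Fin n) : Equiv.Perm (Fin n) :=
  (twoBlockFun_involutive n p).toPerm

theorem twoBlockPerm_val {n : ℕ} (p i : Fin n) :
    (twoBlockPerm n p i : ℕ) = if (i : ℕ) ≤ p then (p : ℕ) - i else n + p - i :=
  rfl

theorem twoBlockPerm_modKAlt {m : ℕ} {p : Fin (2 * m)} (hp : (p : ℕ) % 2 = 0) :
    ModKAlt 2 (twoBlockPerm (2 * m) p) := by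
  intro i
  rw [twoBlockPerm_val]
  split_ifs <;> omega

theorem twoBlockPerm_avoids_231 {n : ℕ} (p : Fin n) : ¬ Pattern3 pat231 (twoBlockPerm n p) := by
  rw [pattern3_pat231_iff]
  rintro ⟨a, b, c, hab, hbc, hca, hab'⟩
  simp only [Fin.lt_def, twoBlockPerm_val] at *
  split_ifs at * <;> omega

theorem twoBlockPerm_avoids_123 {n : ℕ} (p : Fin n) : ¬ Pattern3 pat123 (twoBlockPerm n p) := by
  rw [pattern3_pat123_iff]
  rintro ⟨a, b, c, hab, hbc, hab', hbc'⟩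
  simp only [Fin.lt_def, twoBlockPerm_val] at *
  split_ifs at * <;> omega

theorem eq_twoBlockPerm_of_avoids {m : ℕ} (hm : 1 ≤ m) {π : Equiv.Perm (Fin (2 * m))}
    (hπ : ModKAlt 2 π) (h231 : ¬ Pattern3 pat231 π) (h123 : ¬ Pattern3 pat123 π) :
    ∃ p : Fin (2 * m), (p : ℕ) % 2 = 0 ∧ π = twoBlockPerm (2 * m) p := by
  rw [pattern3_pat231_iff] at h231
  rw [pattern3_pat123_iff] at h123
  push Not at h231 h123
  obtain ⟨p, hp⟩ := π.surjective ⟨0, by omega⟩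
  obtain ⟨q, hq⟩ := π.surjective ⟨2 * m - 1, by omega⟩
  have hp_even := hπ p
  have hq_odd := hπ q
  have h0_even := hπ ⟨0, by omega⟩
  have hπp (k) (hk : k ≠ p) : π p < π k := by
    have := π.injective.ne hk
    rw [hp] at this ⊢
    rw [Ne, Fin.ext_iff] at this
    rw [Fin.lt_def]
    dsimp only at *
    omega
  have hπq (k) (hk : k ≠ q) : π k < π q := by
    have := π.injective.ne hk
    rw [hq] at this ⊢
    rw [Ne, Fin.ext_iff] at this
    rw [Fin.lt_def]
    dsimp only at *
    omega
  rw [hp] at hp_even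
  rw [hq] at hq_odd
  dsimp only at hp_even hq_odd h0_even
  have hpq : p < q := by
    by_contra h
    have hne : (⟨0, by omega⟩ : Fin (2 * m)) ≠ q := by
      rw [Ne, Fin.ext_iff]; dsimp only; omega
    refine (h231 ⟨0, by omega⟩ q p ?_ ?_ (hπp _ ?_)).not_gt (hπq _ hne)
    · rw [Fin.lt_def]; dsimp only; omega
    · omega
    · rw [Ne, Fin.ext_iff]; dsimp only; omega
  have anti_left (i k) (hik : i < k) (hk : k ≤ p) : π k < π i := by
    rcases hk.eq_or_lt with rfl | hk
    · exact hπp i hik.ne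
    · exact lt_of_le_of_ne (h231 i k p hik hk (hπp i (hik.trans hk).ne))
        (π.injective.ne hik.ne')
  have anti_right (i k) (hi : p < i) (hik : i < k) : π k < π i :=
    lt_of_le_of_ne (h123 p i k hi hik (hπp i hi.ne')) (π.injective.ne hik.ne')
  have left_lt_right (i k) (hi : i ≤ p) (hk : p < k) : π i < π k := by
    rcases lt_trichotomy k q with hkq | rfl | hkq
    · exact absurd (hπq k hkq.ne) (h123 p k q hk hkq (hπp k hk.ne')).not_gt
    · exact hπq i (by omega)
    · by_contra h
      have hlt : π k < π i := lt_of_le_of_ne (not_lt.1 h) (π.injective.ne (by omega))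
      exact (h231 i q k (by omega) hkq hlt).not_gt (hπq i (by omega))
  refine ⟨p, by omega, ?_⟩
  ext i
  rw [twoBlockPerm_val, perm_val_eq_card]
  split_ifs with hi
  · have : ({k | π k < π i} : Finset (Fin (2 * m))) = Ioc i p := by
      ext k
      simp only [mem_filter, mem_univ, true_and, mem_Ioc]
      refine ⟨fun hk => ?_, fun hk => anti_left i k hk.1 hk.2⟩
      have hkp : k ≤ p := not_lt.1 fun h => (left_lt_right i k hi h).not_gt hk
      refine ⟨?_, hkp⟩
      rcases lt_trichotomy i k with h | rfl | h
      · exact h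
      · exact absurd hk (lt_irrefl _)
      · exact absurd hk (anti_left k i h hi).not_gt
    rw [this, Fin.card_Ioc]
  · have : ({k | π k < π i} : Finset (Fin (2 * m))) = Iic p ∪ Ioi i := by
      ext k
      simp only [mem_filter, mem_univ, true_and, mem_union, mem_Iic, mem_Ioi]
      refine ⟨fun hk => ?_, fun hk => ?_⟩
      · by_contra! h
        rcases h.2.eq_or_lt with rfl | hki
        · exact lt_irrefl _ hk
        · exact (anti_right k i h.1 hki).not_gt hk
      · rcases hk with hk | hk
        · exact left_lt_right k i hk (by omega)
        · exact anti_right i k (by omega) hk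
    rw [this, card_union_of_disjoint, Fin.card_Iic, Fin.card_Ioi]
    · omega
    · rw [Finset.disjoint_left]
      intro k hk hk'
      rw [mem_Iic] at hk
      rw [mem_Ioi] at hk'
      omega

theorem mpPat2_two_pat231_pat123 {m : ℕ} (hm : 1 ≤ m) :
    mpPat2 2 pat231 pat123 (2 * m) = m := by
  let F : Fin m → {π : Equiv.Perm (Fin (2 * m)) //
      ModKAlt 2 π ∧ ¬ Pattern3 pat231 π ∧ ¬ Pattern3 pat123 π} := fun t =>
    ⟨twoBlockPerm (2 * m) ⟨2 * t, by omega⟩, twoBlockPerm_modKAlt (by dsimp only; omega),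
      twoBlockPerm_avoids_231 _, twoBlockPerm_avoids_123 _⟩
  have hF : Function.Bijective F := by
    constructor
    · intro s t hst
      have h := congrArg (fun π => (π.1 ⟨0, by omega⟩ : ℕ)) hst
      simp only [F, twoBlockPerm_val] at h
      ext
      simpa using h
    · rintro ⟨π, hπ, h231, h123⟩
      obtain ⟨p, hp, rfl⟩ := eq_twoBlockPerm_of_avoids hm hπ h231 h123
      refine ⟨⟨p / 2, by omega⟩, Subtype.ext ?_⟩
      simp only [F]
      congr 1
      ext
      dsimp only
      omega
  rw [mpPat2, ← Nat.card_eq_of_bijective F hF, Nat.card_fin]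

theorem pap_231_123_count (m : ℕ) (hm : 1 ≤ m) :
    mpPat2 2 pat231 pat123 (2 * m) = m ∧
    ∀ π : Equiv.Perm (Fin (2 * m)),
      ModKAlt 2 π → ¬ Pattern3 pat231 π → ¬ Pattern3 pat123 π →
      ∃ j : ℕ, Odd j ∧ 1 ≤ j ∧ j ≤ 2 * m ∧
        ∀ i : Fin (2 * m),
          ((i : ℕ) < j → (π i : ℕ) = j - 1 - (i : ℕ)) ∧
          (j ≤ (i : ℕ) → (π i : ℕ) = 2 * m - 1 + j - (i : ℕ)) := by
  refine ⟨mpPat2_two_pat231_pat123 hm, fun π hπ h231 h123 => ?_⟩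
  obtain ⟨p, hp, rfl⟩ := eq_twoBlockPerm_of_avoids hm hπ h231 h123
  refine ⟨p + 1, ?_, by omega, by omega, fun i => ?_⟩
  · rw [Nat.odd_iff]; omega
  · rw [twoBlockPerm_val]
    split_ifs <;> omega
end

section
/- Let k ≥ 1, m ≥ 0, and 0 ≤ l < k. Then the number mp_{321,132}(km+l, k) of mod-k-alternating permutations of [km+l] avoiding both 321 and 132 equals binom(m,2) + 1. -/
open Finset

theorem pattern3_pat321_iff {n : ℕ} (π : Equiv.Perm (Fin n)) :
    Pattern3 pat321 π ↔ ∃ a b c : Fin n, a < b ∧ b < c ∧ π c < π b ∧ π b < π a := by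
  constructor
  · rintro ⟨f, hf, h⟩
    exact ⟨f 0, f 1, f 2, hf (by decide), hf (by decide),
      (h 2 1).1 (by decide), (h 1 0).1 (by decide)⟩
  · rintro ⟨a, b, c, hab, hbc, h₁, h₂⟩
    refine ⟨![a, b, c], ?_, ?_⟩
    · intro x y hxy
      fin_cases x <;> fin_cases y <;> simp_all
      all_goals omega
    · have e0 : pat321 0 = 2 := by decide
      have e1 : pat321 1 = 1 := by decide
      have e2 : pat321 2 = 0 := by decide
      intro x y
      fin_cases x <;> fin_cases y <;> simp [e0, e1, e2] <;> omega

theorem pattern3_pat132_iff {n : ℕ} (π : Equiv.Perm (Fin n)) :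
    Pattern3 pat132 π ↔ ∃ a b c : Fin n, a < b ∧ b < c ∧ π a < π c ∧ π c < π b := by
  constructor
  · rintro ⟨f, hf, h⟩
    exact ⟨f 0, f 1, f 2, hf (by decide), hf (by decide),
      (h 0 2).1 (by decide), (h 2 1).1 (by decide)⟩
  · rintro ⟨a, b, c, hab, hbc, h₁, h₂⟩
    refine ⟨![a, b, c], ?_, ?_⟩
    · intro x y hxy
      fin_cases x <;> fin_cases y <;> simp_all
      all_goals omega
    · have e0 : pat132 0 = 0 := by decide
      have e1 : pat132 1 = 2 := by decide
      have e2 : pat132 2 = 1 := by decide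
      intro x y
      fin_cases x <;> fin_cases y <;> simp [e0, e1, e2] <;> omega

/-- The map on `ℕ` that exchanges the adjacent blocks `[0, p)` and `[p, p + v)`, preserving the
order inside each block, and fixes everything from `p + v` on. -/
def blockSwapFun (p v i : ℕ) : ℕ :=
  if i < p then i + v else if i < p + v then i - p else i

/-- The permutation of `Fin n` with word `v, …, v + p - 1, 0, …, v - 1, p + v, …, n - 1`. -/
def blockSwap {n : ℕ} (p v : ℕ) (h : p + v ≤ n) : Equiv.Perm (Fin n) where
  toFun i := ⟨blockSwapFun p v i, by unfold blockSwapFun; split_ifs <;> omega⟩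
  invFun i := ⟨blockSwapFun v p i, by unfold blockSwapFun; split_ifs <;> omega⟩
  left_inv i := by
    ext
    simp only [blockSwapFun]
    split_ifs <;> omega
  right_inv i := by
    ext
    simp only [blockSwapFun]
    split_ifs <;> omega

theorem blockSwap_val {n p v : ℕ} (h : p + v ≤ n) (i : Fin n) :
    (blockSwap p v h i : ℕ) = blockSwapFun p v i := rfl

theorem blockSwap_symm_val {n p v : ℕ} (h : p + v ≤ n) (i : Fin n) :
    ((blockSwap p v h).symm i : ℕ) = blockSwapFun v p i := rfl

theorem blockSwap_zero_right {n p : ℕ} (h : p + 0 ≤ n) :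
    blockSwap p 0 h = (1 : Equiv.Perm (Fin n)) := by
  ext i
  simp only [blockSwap_val, blockSwapFun, Equiv.Perm.one_apply]
  split_ifs <;> omega

theorem blockSwap_inj {n p v p' v' : ℕ} (h : p + v ≤ n) (h' : p' + v' ≤ n)
    (hp : 0 < p) (hv : 0 < v) (hp' : 0 < p') (hv' : 0 < v')
    (he : blockSwap p v h = blockSwap p' v' h') : p = p' ∧ v = v' := by
  have h₁ := congrArg (fun σ : Equiv.Perm (Fin n) => (σ ⟨0, by omega⟩ : ℕ)) he
  have h₂ := congrArg (fun σ : Equiv.Perm (Fin n) => (σ.symm ⟨0, by omega⟩ : ℕ)) he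
  simp only [blockSwap_val, blockSwap_symm_val, blockSwapFun, hp, hv, hp', hv', if_true] at h₁ h₂
  omega

theorem blockSwap_avoids_pat321 {n p v : ℕ} (h : p + v ≤ n) :
    ¬ Pattern3 pat321 (blockSwap p v h) := by
  rw [pattern3_pat321_iff]
  rintro ⟨a, b, c, hab, hbc, h₁, h₂⟩
  simp only [Fin.lt_def, blockSwap_val, blockSwapFun] at *
  split_ifs at * <;> omega

theorem blockSwap_avoids_pat132 {n p v : ℕ} (h : p + v ≤ n) :
    ¬ Pattern3 pat132 (blockSwap p v h) := by
  rw [pattern3_pat132_iff]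
  rintro ⟨a, b, c, hab, hbc, h₁, h₂⟩
  simp only [Fin.lt_def, blockSwap_val, blockSwapFun] at *
  split_ifs at * <;> omega

theorem blockSwap_modKAlt {n k p v : ℕ} (h : p + v ≤ n) (hp : k ∣ p) (hv : k ∣ v) :
    ModKAlt k (blockSwap p v h) := by
  intro i
  rw [blockSwap_val, blockSwapFun]
  split_ifs with h₁ h₂
  · exact (Nat.ModEq.trans (Nat.ModEq.add_left _ (Nat.modEq_zero_iff_dvd.2 hv)) rfl)
  · exact (Nat.modEq_iff_dvd' (Nat.sub_le _ _)).2
      (by rwa [Nat.sub_sub_self (by omega)])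
  · rfl

/-- A permutation avoiding 321 and 132 exchanges two adjacent initial blocks, whose lengths are
the position and the image of `0`. -/
theorem eq_blockSwap_of_avoids {n : ℕ} (hn : 0 < n) (π : Equiv.Perm (Fin n))
    (h321 : ¬ Pattern3 pat321 π) (h132 : ¬ Pattern3 pat132 π) :
    ∃ h : (π.symm ⟨0, hn⟩ : ℕ) + (π ⟨0, hn⟩ : ℕ) ≤ n,
      π = blockSwap (π.symm ⟨0, hn⟩ : ℕ) (π ⟨0, hn⟩ : ℕ) h := by
  rw [pattern3_pat321_iff] at h321
  rw [pattern3_pat132_iff] at h132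
  obtain ⟨P, hP⟩ : ∃ P, P = π.symm ⟨0, hn⟩ := ⟨_, rfl⟩
  obtain ⟨V, hV⟩ : ∃ V, V = π ⟨0, hn⟩ := ⟨_, rfl⟩
  rw [← hP, ← hV]
  have hπP : (π P : ℕ) = 0 := by rw [hP, Equiv.apply_symm_apply]
  have first : ∀ i (hi : i < n), i < (P : ℕ) → (π ⟨i, hi⟩ : ℕ) = V + i := by
    intro i
    induction i using Nat.strong_induction_on with
    | _ i ih =>
      intro hi hiP
      rcases i with _ | i
      · rw [hV]; rfl
      have hpre := ih i (by omega) (by omega) (by omega)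
      have hgt : (π ⟨i, by omega⟩ : ℕ) < π ⟨i + 1, hi⟩ := by
        by_contra hcon
        have hne : (π ⟨i, by omega⟩ : ℕ) ≠ π ⟨i + 1, hi⟩ := fun e => by
          have := π.injective (Fin.ext e)
          simp at this
        have hne' : (π P : ℕ) ≠ π ⟨i + 1, hi⟩ := fun e => by
          have := congrArg Fin.val (π.injective (Fin.ext e))
          simp at this
          omega
        refine h321 ⟨⟨i, by omega⟩, ⟨i + 1, hi⟩, P, ?_, ?_, ?_, ?_⟩ <;>
          simp only [Fin.lt_def] <;> omega
      by_contra hcon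
      obtain ⟨q, hq⟩ := π.surjective ⟨V + (i + 1), by have := (π ⟨i + 1, hi⟩).isLt; omega⟩
      have hqv : (π q : ℕ) = V + (i + 1) := by rw [hq]
      have hqi : i + 1 < (q : ℕ) := by
        by_contra hle
        rcases Nat.lt_or_ge q (i + 1) with hlt | hge
        · have : (π q : ℕ) = V + q := ih q hlt q.isLt (by omega)
          omega
        · have : q = ⟨i + 1, hi⟩ := Fin.ext (by simp only; omega)
          rw [this] at hqv
          exact hcon hqv
      refine h132 ⟨⟨i, by omega⟩, ⟨i + 1, hi⟩, q, ?_, ?_, ?_, ?_⟩ <;>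
        simp only [Fin.lt_def] <;> omega
  have hsum : (P : ℕ) + V ≤ n := by
    rcases Nat.eq_zero_or_pos (P : ℕ) with h0 | hpos
    · have := V.isLt
      omega
    · have h₁ := first (P - 1) (by omega) (by omega)
      have h₂ := (π ⟨P - 1, by omega⟩).isLt
      omega
  refine ⟨hsum, ?_⟩
  have key : ∀ i (hi : i < n), π ⟨i, hi⟩ = blockSwap P V hsum ⟨i, hi⟩ := by
    intro i
    induction i using Nat.strong_induction_on with
    | _ i ih =>
      intro hi
      set σ := blockSwap (P : ℕ) V hsum with hσ
      rcases lt_trichotomy i (P : ℕ) with hlt | heq | hgt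
      · refine Fin.ext ?_
        rw [first i hi hlt, hσ, blockSwap_val, blockSwapFun]
        simp only [hlt, if_true]
        omega
      · have hiP : (⟨i, hi⟩ : Fin n) = P := Fin.ext heq
        refine Fin.ext ?_
        rw [hiP, hπP, hσ, blockSwap_val, blockSwapFun]
        have hV0 : (V : ℕ) = 0 → (P : ℕ) = 0 := by
          intro h0
          have : π ⟨0, hn⟩ = π P := Fin.ext (by rw [hπP, ← hV, h0])
          rw [← π.injective this]
        split_ifs <;> omega
      · by_contra hne
        obtain ⟨q, hq⟩ := π.surjective (σ ⟨i, hi⟩)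
        have hqi : i < (q : ℕ) := by
          by_contra hle
          rcases Nat.lt_or_ge q i with hlt | hge
          · have h₁ := ih q hlt q.isLt
            have h₂ := σ.injective (h₁.symm.trans hq)
            have := congrArg Fin.val h₂
            simp only at this
            omega
          · have : q = ⟨i, hi⟩ := Fin.ext (by simp only; omega)
            exact hne (this ▸ hq)
        obtain ⟨j, hj⟩ := σ.surjective (π ⟨i, hi⟩)
        have hji : i < (j : ℕ) := by
          by_contra hle
          rcases Nat.lt_or_ge j i with hlt | hge
          · have h₁ := ih j hlt j.isLt
            have h₂ := π.injective (h₁.trans hj)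
            have := congrArg Fin.val h₂
            simp only at this
            omega
          · have : j = ⟨i, hi⟩ := Fin.ext (by simp only; omega)
            exact hne (this ▸ hj.symm)
        have hmono : 0 < (σ ⟨i, hi⟩ : ℕ) ∧ (σ ⟨i, hi⟩ : ℕ) < σ j := by
          rw [hσ, blockSwap_val, blockSwap_val]
          unfold blockSwapFun
          simp only
          split_ifs <;> omega
        refine h132 ⟨P, ⟨i, hi⟩, q, hgt, hqi, ?_, ?_⟩
        · rw [Fin.lt_def, hπP, hq]
          exact hmono.1
        · rw [Fin.lt_def, hq, ← hj]
          exact hmono.2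
  exact Equiv.ext fun i => key i i.isLt

theorem mp_321_132_count (k m l : ℕ) (hk : 1 ≤ k) (hl : l < k) :
    mpPat2 k pat321 pat132 (k * m + l) = m.choose 2 + 1 := by
  have hbound : ∀ (j : Fin m) (i : Fin j),
      k * ((i : ℕ) + 1) + k * ((j : ℕ) - i) ≤ k * m + l := by
    intro j i
    rw [← Nat.mul_add]
    exact (Nat.mul_le_mul_left k (by omega)).trans (Nat.le_add_right _ _)
  have hpos : ∀ a, 0 < a → 0 < k * a := fun a ha => Nat.mul_pos hk ha
  let F : Option (Σ j : Fin m, Fin j) → {π : Equiv.Perm (Fin (k * m + l)) //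
      ModKAlt k π ∧ ¬ Pattern3 pat321 π ∧ ¬ Pattern3 pat132 π} := fun x => match x with
    | none => ⟨blockSwap 0 0 (Nat.zero_le _), blockSwap_modKAlt _ (dvd_zero k) (dvd_zero k),
        blockSwap_avoids_pat321 _, blockSwap_avoids_pat132 _⟩
    | some ⟨j, i⟩ => ⟨blockSwap _ _ (hbound j i),
        blockSwap_modKAlt _ (dvd_mul_right _ _) (dvd_mul_right _ _),
        blockSwap_avoids_pat321 _, blockSwap_avoids_pat132 _⟩
  have hne : ∀ (j : Fin m) (i : Fin j), F none ≠ F (some ⟨j, i⟩) := by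
    intro j i he
    have hp := hpos ((i : ℕ) + 1) (by omega)
    have hv := hpos ((j : ℕ) - i) (by omega)
    have hb := hbound j i
    have h₁ := congrArg (fun σ => (σ.1 ⟨0, by omega⟩ : ℕ)) he
    simp only [F, blockSwap_val, blockSwapFun, hp, if_true] at h₁
    simp at h₁
    omega
  have hF : Function.Bijective F := by
    constructor
    · rintro (_ | ⟨j, i⟩) (_ | ⟨j', i'⟩) he
      · rfl
      · exact (hne _ _ he).elim
      · exact (hne _ _ he.symm).elim
      · obtain ⟨h₁, h₂⟩ := blockSwap_inj (hbound j i) (hbound j' i')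
          (hpos _ (by omega)) (hpos _ (by omega)) (hpos _ (by omega)) (hpos _ (by omega))
          (congrArg Subtype.val he)
        have h₃ := Nat.eq_of_mul_eq_mul_left hk h₁
        have h₄ := Nat.eq_of_mul_eq_mul_left hk h₂
        have hj : j = j' := Fin.ext (by omega)
        subst hj
        have hi : i = i' := Fin.ext (by omega)
        rw [hi]
    · rintro ⟨π, hmod, h321, h132⟩
      rcases Nat.eq_zero_or_pos (k * m + l) with h0 | hn
      · refine ⟨none, Subtype.ext (Equiv.ext fun i => ?_)⟩
        have := i.isLt
        omega
      obtain ⟨h, hπ⟩ := eq_blockSwap_of_avoids hn π h321 h132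
      have hv : k ∣ (π ⟨0, hn⟩ : ℕ) := by
        have := hmod ⟨0, hn⟩
        exact Nat.dvd_of_mod_eq_zero (by simpa using this)
      have hp : k ∣ (π.symm ⟨0, hn⟩ : ℕ) := by
        have := hmod (π.symm ⟨0, hn⟩)
        exact Nat.dvd_of_mod_eq_zero (by simpa using this.symm)
      have hzero : (π.symm ⟨0, hn⟩ : ℕ) = 0 → (π ⟨0, hn⟩ : ℕ) = 0 := by
        intro e
        have : π.symm ⟨0, hn⟩ = ⟨0, hn⟩ := Fin.ext e
        rw [Equiv.symm_apply_eq] at this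
        rw [← this]
      generalize (π.symm ⟨0, hn⟩ : ℕ) = p at *
      generalize (π ⟨0, hn⟩ : ℕ) = v at *
      obtain ⟨a, rfl⟩ := hp
      obtain ⟨b, rfl⟩ := hv
      subst hπ
      rcases Nat.eq_zero_or_pos b with rfl | hb
      · refine ⟨none, Subtype.ext ?_⟩
        change blockSwap 0 0 (Nat.zero_le _) = blockSwap (k * a) 0 h
        rw [blockSwap_zero_right, blockSwap_zero_right]
      · have ha : 0 < a := by
          rcases Nat.eq_zero_or_pos a with rfl | ha
          · have := hzero (Nat.mul_zero k)
            have := hpos b hb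
            omega
          · exact ha
        have hab : a + b ≤ m := by
          by_contra hcon
          have := Nat.mul_le_mul_left k (show m + 1 ≤ a + b by omega)
          rw [Nat.mul_add, Nat.mul_add] at this
          omega
        refine ⟨some ⟨⟨a + b - 1, by omega⟩, ⟨a - 1, by simp only; omega⟩⟩, Subtype.ext ?_⟩
        have e₁ : a - 1 + 1 = a := by omega
        have e₂ : a + b - 1 - (a - 1) = b := by omega
        simp only [F, e₁, e₂]
  rw [mpPat2, ← Nat.card_congr (Equiv.ofBijective F hF), Nat.card_eq_fintype_card,
    Fintype.card_option, Fintype.card_sigma]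
  simp only [Fintype.card_fin]
  rw [Fin.sum_univ_eq_sum_range (fun j => j) m, Finset.sum_range_id, Nat.choose_two_right]
end
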